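/- Let n̄ = (n₁,…,n_r), and let k be the number of indices i > 1 with nᵢ even. Then TC(P_{n̄}) < (TC(P^{n₁}) + 1)(r + k), where TC is reduced topological complexity. -/

import Mathlib

noncomputable section

open unitInterval Set

/-- The double evaluation map `X^{[0,1]} → X × X`, sending a path `γ : [0,1] → X`
to the pair of its endpoints `(γ(0), γ(1))`. -/
def pathEval (X : Type*) [TopologicalSpace X] (γ : C(I, X)) : X × X := (γ 0, γ 1)

/-- `X × X` admits a cover by `k + 1` open sets on each of which the double evaluation
map `X^{[0,1]} → X × X` admits a continuous section. -/
def TCCover (X : Type*) [TopologicalSpace X] (k : ℕ) : Prop :=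
  ∃ U : Fin (k + 1) → Set (X × X),
    (∀ i, IsOpen (U i)) ∧ (⋃ i, U i) = Set.univ ∧
    ∀ i, ∃ s : C(U i, C(I, X)), ∀ u : U i, pathEval X (s u) = (u : X × X)

/-- Farber's (reduced) topological complexity, as an element of `ℕ∞`. -/
def topComplexity (X : Type*) [TopologicalSpace X] : ℕ∞ :=
  sInf {c : ℕ∞ | ∃ k : ℕ, TCCover X k ∧ c = k}

/-- `X × X` admits a cover by `k + 1` `G`-invariant open sets (for the diagonal `G`-action)
on each of which the double evaluation map admits a continuous `G`-equivariant section. -/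
def EqTCCover (G X : Type*) [Group G] [TopologicalSpace X] [MulAction G X] (k : ℕ) : Prop :=
  ∃ U : Fin (k + 1) → Set (X × X),
    (∀ i, IsOpen (U i)) ∧ (⋃ i, U i) = Set.univ ∧
    (∀ i (g : G) p, p ∈ U i → g • p ∈ U i) ∧
    ∀ i, ∃ s : C(U i, C(I, X)),
      (∀ u : U i, pathEval X (s u) = (u : X × X)) ∧
      ∀ (g : G) (u : U i) (hg : g • (u : X × X) ∈ U i) (t : I),
        (s ⟨g • (u : X × X), hg⟩) t = g • (s u) t

/-- The (reduced) equivariant topological complexity `TC_G(X)` of Colman–Grant,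
as an element of `ℕ∞`. -/
def eqTC (G X : Type*) [Group G] [TopologicalSpace X] [MulAction G X] : ℕ∞ :=
  sInf {c : ℕ∞ | ∃ k : ℕ, EqTCCover G X k ∧ c = k}

open Metric

/-- `S_{n̄} = S^{n₁} × ⋯ × S^{n_r}`, the product of unit spheres. -/
abbrev SphereProd {r : ℕ} (n : Fin r → ℕ) : Type :=
  Π i : Fin r, Metric.sphere (0 : EuclideanSpace ℝ (Fin (n i + 1))) 1

/-- The setoid on `S_{n̄}` identifying each point with its image under the diagonal
antipodal involution. -/
def ppsSetoid {r : ℕ} (n : Fin r → ℕ) : Setoid (SphereProd n) :=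
  ⟨fun x y => y = x ∨ y = -x, by
    constructor
    · intro x; exact Or.inl rfl
    · rintro x y (rfl | rfl)
      · exact Or.inl rfl
      · right; simp
    · rintro x y z (rfl | rfl) (rfl | rfl)
      · exact Or.inl rfl
      · exact Or.inr rfl
      · exact Or.inr rfl
      · left; simp⟩

/-- Davis' projective product space `P_{n̄}`: the quotient of `S_{n̄}` by the diagonal
(free) antipodal `ℤ/2`-action. -/
def PPS {r : ℕ} (n : Fin r → ℕ) : Type := Quotient (ppsSetoid n)

instance {r : ℕ} (n : Fin r → ℕ) : TopologicalSpace (PPS n) :=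
  instTopologicalSpaceQuotient

/-- The quotient map `S_{n̄} → P_{n̄}`. -/
def ppsMk {r : ℕ} (n : Fin r → ℕ) : SphereProd n → PPS n := Quotient.mk _

/-- The setoid on the sphere `Sᵏ` identifying antipodal points. -/
def rpSetoid (k : ℕ) : Setoid (Metric.sphere (0 : EuclideanSpace ℝ (Fin (k + 1))) 1) :=
  ⟨fun x y => y = x ∨ y = -x, by
    constructor
    · intro x; exact Or.inl rfl
    · rintro x y (rfl | rfl)
      · exact Or.inl rfl
      · right; simp
    · rintro x y z (rfl | rfl) (rfl | rfl)
      · exact Or.inl rfl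
      · exact Or.inr rfl
      · exact Or.inr rfl
      · left; simp⟩

/-- Real projective space `Pᵏ` as the quotient of the sphere `Sᵏ` by the antipodal map. -/
def RP (k : ℕ) : Type := Quotient (rpSetoid k)

instance (k : ℕ) : TopologicalSpace (RP k) := instTopologicalSpaceQuotient

/-- The quotient map `Sᵏ → Pᵏ`. -/
def rpMk (k : ℕ) : Metric.sphere (0 : EuclideanSpace ℝ (Fin (k + 1))) 1 → RP k :=
  Quotient.mk _

/-- A continuous map `g : P_{n̄} × P_{m̄} → Pᵏ` is *axial* if it corresponds to the
cohomology class `x ⊗ 1 + 1 ⊗ x`; equivalently (and this is the formulation used here),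
if it admits a continuous lift `g̃ : S_{n̄} × S_{m̄} → Sᵏ` which is `ℤ/2`-equivariant in
each variable separately: `g̃(-x, y) = g̃(x, -y) = -g̃(x, y)`. -/
def IsAxialMap {r s : ℕ} (n : Fin r → ℕ) (m : Fin s → ℕ) (k : ℕ)
    (g : PPS n × PPS m → RP k) : Prop :=
  Continuous g ∧
  ∃ gt : SphereProd n × SphereProd m →
      Metric.sphere (0 : EuclideanSpace ℝ (Fin (k + 1))) 1,
    Continuous gt ∧
    (∀ x y, gt (-x, y) = -gt (x, y)) ∧
    (∀ x y, gt (x, -y) = -gt (x, y)) ∧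
    (∀ x y, rpMk k (gt (x, y)) = g (ppsMk n x, ppsMk m y))

section SpherePath

variable {E : Type*} [NormedAddCommGroup E] [InnerProductSpace ℝ E]

/-- The piecewise linear path through the four points `a`, `b`, `c`, `d`. -/
def fourPointPath (a b c d : E) (t : ℝ) : E :=
  max 0 (1 - 3 * t) • a + max 0 (1 - |3 * t - 1|) • b + max 0 (1 - |3 * t - 2|) • c +
    max 0 (3 * t - 2) • d

lemma segment_ne_zero {a b : E} (ha : ‖a‖ = 1) (hb : ‖b‖ = 1) (hab : a ≠ -b) {s : ℝ}
    (h0 : 0 ≤ s) (h1 : s ≤ 1) : (1 - s) • a + s • b ≠ 0 := by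
  intro h
  have h' : (1 - s) • a = -(s • b) := eq_neg_of_add_eq_zero_left h
  have hn := congrArg norm h'
  rw [norm_neg, norm_smul, norm_smul, ha, hb, mul_one, mul_one, Real.norm_of_nonneg h0,
    Real.norm_of_nonneg (by linarith)] at hn
  have hs : s = 1 / 2 := by linarith
  subst hs
  apply hab
  have h2 : (1 / 2 : ℝ) • a = (1 / 2 : ℝ) • (-b) := by
    rw [smul_neg, ← h']; norm_num
  exact smul_right_injective E (by norm_num : (1 / 2 : ℝ) ≠ 0) h2

lemma fourPointPath_ne_zero {a b c d : E} (ha : ‖a‖ = 1) (hb : ‖b‖ = 1) (hc : ‖c‖ = 1)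
    (hd : ‖d‖ = 1) (hab : a ≠ -b) (hbc : b ≠ -c) (hcd : c ≠ -d) {t : ℝ} (h0 : 0 ≤ t)
    (h1 : t ≤ 1) : fourPointPath a b c d t ≠ 0 := by
  unfold fourPointPath
  rcases le_total (3 * t) 1 with h | h
  · rw [max_eq_right (by linarith), abs_of_nonpos (by linarith), abs_of_nonpos (by linarith),
      max_eq_right (by linarith), max_eq_left (by linarith), max_eq_left (by linarith)]
    have := segment_ne_zero ha hb hab (by linarith : 0 ≤ 3 * t) h
    rwa [zero_smul, zero_smul, add_zero, add_zero, show 1 - -(3 * t - 1) = 3 * t by ring]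
  rcases le_total (3 * t) 2 with h' | h'
  · rw [max_eq_left (by linarith), abs_of_nonneg (by linarith), abs_of_nonpos (by linarith),
      max_eq_right (by linarith), max_eq_right (by linarith), max_eq_left (by linarith)]
    have := segment_ne_zero hb hc hbc (by linarith : 0 ≤ 3 * t - 1) (by linarith)
    rwa [zero_smul, zero_smul, add_zero, zero_add,
      show 1 - -(3 * t - 2) = 3 * t - 1 by ring]
  · rw [max_eq_left (by linarith), abs_of_nonneg (by linarith), abs_of_nonneg (by linarith),
      max_eq_left (by linarith), max_eq_right (by linarith), max_eq_right (by linarith)]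
    have := segment_ne_zero hc hd hcd (by linarith : 0 ≤ 3 * t - 2) (by linarith)
    rwa [zero_smul, zero_smul, add_zero, zero_add]

open Classical in
/-- The radial projection onto the unit sphere, with a default value at `0`. -/
def toSphere (x₀ : sphere (0 : E) 1) (p : E) : sphere (0 : E) 1 :=
  if h : p = 0 then x₀ else ⟨‖p‖⁻¹ • p, by simp [norm_smul, h]⟩

lemma coe_toSphere (x₀ : sphere (0 : E) 1) {p : E} (hp : p ≠ 0) :
    (toSphere x₀ p : E) = ‖p‖⁻¹ • p := by
  simp [toSphere, hp]

lemma toSphere_neg (x₀ x₁ : sphere (0 : E) 1) {p : E} (hp : p ≠ 0) :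
    toSphere x₀ (-p) = -toSphere x₁ p := by
  ext1
  rw [coe_toSphere _ (neg_ne_zero.mpr hp), coe_neg_sphere, coe_toSphere _ hp]
  simp

lemma toSphere_coe (x₀ x : sphere (0 : E) 1) : toSphere x₀ (x : E) = x := by
  ext1
  rw [coe_toSphere _ (ne_zero_of_mem_unit_sphere x)]
  simp

lemma ContinuousOn.toSphere {Z : Type*} [TopologicalSpace Z] {W : Set Z} {f : Z → E}
    (hf : ContinuousOn f W) (h0 : ∀ z ∈ W, f z ≠ 0) (x₀ : Z → sphere (0 : E) 1) :
    ContinuousOn (fun z => _root_.toSphere (x₀ z) (f z)) W := by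
  rw [Topology.IsInducing.subtypeVal.continuousOn_iff]
  refine ContinuousOn.congr (f := fun z => ‖f z‖⁻¹ • f z) ?_ fun z hz => coe_toSphere _ (h0 z hz)
  exact (hf.norm.inv₀ fun z hz => norm_ne_zero_iff.mpr (h0 z hz)).smul hf

/-- The path on the unit sphere through the four points `a`, `b`, `c`, `d`. -/
def spherePath (a b c d : sphere (0 : E) 1) (t : I) : sphere (0 : E) 1 :=
  toSphere a (fourPointPath (a : E) b c d t)

lemma sphere_path_ne_zero {a b c d : sphere (0 : E) 1} (hab : a ≠ -b) (hbc : b ≠ -c)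
    (hcd : c ≠ -d) (t : I) : fourPointPath (a : E) b c d t ≠ 0 :=
  fourPointPath_ne_zero (norm_eq_of_mem_sphere a) (norm_eq_of_mem_sphere b)
    (norm_eq_of_mem_sphere c) (norm_eq_of_mem_sphere d)
    (fun h => hab (Subtype.ext h)) (fun h => hbc (Subtype.ext h)) (fun h => hcd (Subtype.ext h))
    t.2.1 t.2.2

lemma spherePath_zero (a b c d : sphere (0 : E) 1) : spherePath a b c d 0 = a := by
  have : fourPointPath (a : E) b c d (0 : I) = a := by
    simp [fourPointPath]
  rw [spherePath, this, toSphere_coe]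

lemma spherePath_one (a b c d : sphere (0 : E) 1) : spherePath a b c d 1 = d := by
  have : fourPointPath (a : E) b c d (1 : I) = d := by
    norm_num [fourPointPath]
  rw [spherePath, this, toSphere_coe]

lemma spherePath_neg {a b c d : sphere (0 : E) 1} (hab : a ≠ -b) (hbc : b ≠ -c)
    (hcd : c ≠ -d) (t : I) : spherePath (-a) (-b) (-c) (-d) t = -spherePath a b c d t := by
  have : fourPointPath ((-a : sphere (0 : E) 1) : E) (-b : sphere (0 : E) 1)
      (-c : sphere (0 : E) 1) (-d : sphere (0 : E) 1) t = -fourPointPath (a : E) b c d t := by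
    simp only [fourPointPath, coe_neg_sphere, smul_neg, neg_add]
  rw [spherePath, this, toSphere_neg _ a (sphere_path_ne_zero hab hbc hcd t), spherePath]

lemma continuousOn_spherePath {Z : Type*} [TopologicalSpace Z] {W : Set Z}
    {a b c d : Z → sphere (0 : E) 1} (ha : ContinuousOn a W) (hb : ContinuousOn b W)
    (hc : ContinuousOn c W) (hd : ContinuousOn d W) (hab : ∀ z ∈ W, a z ≠ -b z)
    (hbc : ∀ z ∈ W, b z ≠ -c z) (hcd : ∀ z ∈ W, c z ≠ -d z) :
    ContinuousOn (fun p : Z × I => spherePath (a p.1) (b p.1) (c p.1) (d p.1) p.2)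
      (W ×ˢ univ) := by
  have key : ∀ {f : Z → sphere (0 : E) 1}, ContinuousOn f W →
      ContinuousOn (fun p : Z × I => (f p.1 : E)) (W ×ˢ univ) := fun hf =>
    continuous_subtype_val.comp_continuousOn
      (hf.comp continuousOn_fst fun p hp => hp.1)
  have ht : ContinuousOn (fun p : Z × I => (p.2 : ℝ)) (W ×ˢ univ) :=
    (continuous_subtype_val.comp continuous_snd).continuousOn
  refine ContinuousOn.toSphere ?_
    (fun p hp => sphere_path_ne_zero (hab _ hp.1) (hbc _ hp.1) (hcd _ hp.1) _) _
  unfold fourPointPath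
  have ha' := key ha
  have hb' := key hb
  have hc' := key hc
  have hd' := key hd
  fun_prop

end SpherePath

lemma continuousOn_ite_of_isOpen {Z Y : Type*} [TopologicalSpace Z] [TopologicalSpace Y]
    {A B : Set Z} (P : Z → Prop) [DecidablePred P] {f g : Z → Y} (hA : IsOpen A) (hB : IsOpen B)
    (hf : ContinuousOn f A) (hg : ContinuousOn g B) (hPA : ∀ z ∈ A, P z)
    (hPB : ∀ z ∈ B, ¬ P z) : ContinuousOn (fun z => if P z then f z else g z) (A ∪ B) := by
  refine ContinuousOn.union_of_isOpen ?_ ?_ hA hB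
  · exact hf.congr fun z hz => if_pos (hPA z hz)
  · exact hg.congr fun z hz => if_neg (hPB z hz)

lemma TCCover.of_fintype {X : Type*} [TopologicalSpace X] {ι : Type*} [Fintype ι] {k : ℕ}
    (hk : Fintype.card ι = k + 1) (U : ι → Set (X × X)) (hU : ∀ i, IsOpen (U i))
    (hcov : ⋃ i, U i = univ)
    (hs : ∀ i, ∃ s : C(U i, C(I, X)), ∀ u : U i, pathEval X (s u) = (u : X × X)) :
    TCCover X k := by
  let e := (Fintype.equivFinOfCardEq hk).symm
  exact ⟨fun i => U (e i), fun i => hU _, by rw [e.surjective.iUnion_comp U, hcov],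
    fun i => hs _⟩

lemma exists_section_of_lift {A P : Type*} [TopologicalSpace A] [TopologicalSpace P]
    [InvolutiveNeg A] {q : A → P} (hq : IsOpenQuotientMap q)
    (hqe : ∀ a b, q a = q b ↔ b = a ∨ b = -a) {W : Set (A × A)} (hW : IsOpen W)
    (hW₁ : ∀ x y, (x, y) ∈ W → (-x, y) ∈ W) (hW₂ : ∀ x y, (x, y) ∈ W → (x, -y) ∈ W)
    (F : (A × A) × I → A) (hF : ContinuousOn F (W ×ˢ univ))
    (hF0 : ∀ x y, (x, y) ∈ W → q (F ((x, y), 0)) = q x)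
    (hF1 : ∀ x y, (x, y) ∈ W → q (F ((x, y), 1)) = q y)
    (hFx : ∀ x y t, (x, y) ∈ W → q (F ((-x, y), t)) = q (F ((x, y), t)))
    (hFy : ∀ x y t, (x, y) ∈ W → q (F ((x, -y), t)) = q (F ((x, y), t))) :
    IsOpen (Prod.map q q '' W) ∧ ∃ s : C(Prod.map q q '' W, C(I, P)),
      ∀ u : Prod.map q q '' W, pathEval P (s u) = (u : P × P) := by
  have hqq : IsOpenQuotientMap (Prod.map q q) := hq.prodMap hq
  have hneg : ∀ x, q (-x) = q x := fun x => (hqe _ _).2 (Or.inr (neg_neg x).symm)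
  have hsat : Prod.map q q ⁻¹' (Prod.map q q '' W) = W := by
    refine Subset.antisymm ?_ (subset_preimage_image _ _)
    rintro ⟨x, y⟩ ⟨⟨x', y'⟩, hxy, he⟩
    obtain ⟨h1, h2⟩ := Prod.ext_iff.1 he
    rcases (hqe _ _).1 h1 with rfl | rfl <;> rcases (hqe _ _).1 h2 with rfl | rfl
    · exact hxy
    · exact hW₂ _ _ hxy
    · exact hW₁ _ _ hxy
    · exact hW₁ _ _ (hW₂ _ _ hxy)
  set V := Prod.map q q '' W with hV
  refine ⟨hqq.isOpenMap _ hW, ?_⟩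
  have hW' : ∀ z : Prod.map q q ⁻¹' V, (z : A × A) ∈ W := fun z => hsat ▸ z.2
  have hQ : Topology.IsQuotientMap
      (Prod.map (V.restrictPreimage (Prod.map q q)) (id : I → I)) :=
    ((hqq.restrictPreimage V).prodMap IsOpenQuotientMap.id).isQuotientMap
  let f : C((Prod.map q q ⁻¹' V) × I, P) :=
    ⟨fun p => q (F ((p.1 : A × A), p.2)), hq.continuous.comp
      (hF.comp_continuous (by fun_prop) fun p => ⟨hW' p.1, mem_univ _⟩)⟩
  have hf : ∀ ⦃a b⦄, Prod.map (V.restrictPreimage (Prod.map q q)) (id : I → I) a =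
      Prod.map (V.restrictPreimage (Prod.map q q)) (id : I → I) b → f a = f b := by
    rintro ⟨⟨⟨x, y⟩, hxy⟩, t⟩ ⟨⟨⟨x', y'⟩, hxy'⟩, t'⟩ h
    obtain ⟨h1, rfl⟩ := Prod.ext_iff.1 h
    have h2 := Prod.ext_iff.1 (Subtype.ext_iff.1 h1)
    have hm : (x, y) ∈ W := hW' ⟨_, hxy⟩
    change q (F ((x, y), t)) = q (F ((x', y'), t))
    rcases (hqe _ _).1 h2.1 with h | h <;> rcases (hqe _ _).1 h2.2 with h' | h' <;> subst h h'
    · rfl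
    · exact (hFy _ _ _ hm).symm
    · exact (hFx _ _ _ hm).symm
    · rw [hFx _ _ _ (hW₂ _ _ hm), hFy _ _ _ hm]
  let Q : C((Prod.map q q ⁻¹' V) × I, V × I) := ⟨_, hQ.continuous⟩
  have hQ' : Topology.IsQuotientMap Q := hQ
  let g : C(V × I, P) := hQ'.lift f hf
  have hg : ∀ (z : A × A) (hz : z ∈ W) (t : I),
      g (⟨Prod.map q q z, mem_image_of_mem _ hz⟩, t) = q (F (z, t)) := fun z hz t => by
    have := DFunLike.congr_fun (hQ'.lift_comp f hf) (⟨z, mem_image_of_mem _ hz⟩, t)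
    exact this
  refine ⟨g.curry, ?_⟩
  rintro ⟨_, ⟨x, y⟩, hxy, rfl⟩
  exact Prod.ext ((hg _ hxy 0).trans (hF0 _ _ hxy)) ((hg _ hxy 1).trans (hF1 _ _ hxy))

lemma isOpenQuotientMap_of_eq_neg {A P : Type*} [TopologicalSpace A] [TopologicalSpace P]
    [InvolutiveNeg A] [ContinuousNeg A] {q : A → P} (hq : Topology.IsQuotientMap q)
    (hqe : ∀ a b, q a = q b ↔ b = a ∨ b = -a) : IsOpenQuotientMap q := by
  refine .of_isOpenMap_isQuotientMap (fun U hU => ?_) hq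
  rw [← hq.isOpen_preimage]
  have : q ⁻¹' (q '' U) = U ∪ Neg.neg ⁻¹' U := by
    ext x
    constructor
    · rintro ⟨y, hy, h⟩
      rcases (hqe _ _).1 h with rfl | rfl
      · exact Or.inl hy
      · right; simpa using hy
    · rintro (h | h)
      · exact ⟨x, h, rfl⟩
      · exact ⟨-x, h, (hqe _ _).2 (Or.inr (neg_neg x).symm)⟩
  rw [this]
  exact hU.union (hU.preimage continuous_neg)

lemma ppsMk_eq_iff {r : ℕ} (n : Fin r → ℕ) (x y : SphereProd n) :
    ppsMk n x = ppsMk n y ↔ y = x ∨ y = -x :=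
  Quotient.eq (r := ppsSetoid n)

/-- The unit sphere `Sᵏ`. -/
abbrev UnitSphere (k : ℕ) : Type := sphere (0 : EuclideanSpace ℝ (Fin (k + 1))) 1

lemma rpMk_eq_iff (k : ℕ) (x y : UnitSphere k) :
    rpMk k x = rpMk k y ↔ y = x ∨ y = -x :=
  Quotient.eq (r := rpSetoid k)

lemma isOpenQuotientMap_ppsMk {r : ℕ} (n : Fin r → ℕ) : IsOpenQuotientMap (ppsMk n) :=
  isOpenQuotientMap_of_eq_neg isQuotientMap_quotient_mk' (ppsMk_eq_iff n)

lemma isQuotientMap_rpMk (k : ℕ) : Topology.IsQuotientMap (rpMk k) :=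
  isQuotientMap_quotient_mk'

lemma isOpenQuotientMap_rpMk (k : ℕ) : IsOpenQuotientMap (rpMk k) :=
  isOpenQuotientMap_of_eq_neg (isQuotientMap_rpMk k) (rpMk_eq_iff k)

lemma rpMk_neg (k : ℕ) (x : UnitSphere k) :
    rpMk k (-x) = rpMk k x :=
  (rpMk_eq_iff k _ _).2 (Or.inr (neg_neg x).symm)

/-- The action of `ℤˣ = {1, -1}` on a type with an involutive negation. -/
@[reducible] def unitsIntNegAction (A : Type*) [InvolutiveNeg A] : MulAction ℤˣ A where
  smul u x := if u = 1 then x else -x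
  one_smul x := if_pos rfl
  mul_smul u v x := by
    change (if u * v = 1 then x else -x) =
      (if u = 1 then (if v = 1 then x else -x) else -(if v = 1 then x else -x))
    rcases Int.units_eq_one_or u with rfl | rfl <;> rcases Int.units_eq_one_or v with rfl | rfl <;>
      simp

lemma isCoveringMap_rpMk (k : ℕ) : IsCoveringMap (rpMk k) := by
  let _ := unitsIntNegAction (UnitSphere k)
  have h1 : ∀ x : UnitSphere k, (-1 : ℤˣ) • x = -x :=
    fun x => if_neg (by decide)
  have hcov : IsQuotientCoveringMap (rpMk k) ℤˣ := by
    refine { isQuotientMap_rpMk k with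
      continuous_const_smul := fun g => ?_
      apply_eq_iff_mem_orbit := fun {x y} => ?_
      disjoint := fun x => ?_ }
    · rcases Int.units_eq_one_or g with rfl | rfl
      · simp only [one_smul]
        exact continuous_id
      · simpa only [h1] using continuous_neg
    · rw [eq_comm, rpMk_eq_iff]
      constructor
      · rintro (rfl | rfl)
        · exact ⟨1, one_smul ℤˣ _⟩
        · exact ⟨-1, h1 _⟩
      · rintro ⟨g, rfl⟩
        rcases Int.units_eq_one_or g with rfl | rfl
        · exact Or.inl (one_smul ℤˣ _)
        · exact Or.inr (h1 _)
    · refine ⟨{y | 0 < inner ℝ (x : EuclideanSpace ℝ (Fin (k + 1))) y}, ?_, ?_⟩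
      · refine (isOpen_lt continuous_const (by fun_prop)).mem_nhds ?_
        simp
      · rintro g ⟨_, ⟨y, hy, rfl⟩, hy'⟩
        rcases Int.units_eq_one_or g with rfl | rfl
        · rfl
        · simp only [h1, mem_ofPred_eq, coe_neg_sphere, inner_neg_right] at hy hy'
          linarith
  exact hcov.isCoveringMap

lemma exists_sphere_lift (k : ℕ) {V : Set (RP k × RP k)} (s : C(V, C(I, RP k)))
    (hs : ∀ u : V, pathEval (RP k) (s u) = (u : RP k × RP k)) :
    ∃ H : (UnitSphere k ×
        UnitSphere k) × I →
        UnitSphere k,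
      ContinuousOn H ((Prod.map (rpMk k) (rpMk k) ⁻¹' V) ×ˢ univ) ∧
      (∀ p, H (p, 0) = p.1) ∧
      (∀ p, Prod.map (rpMk k) (rpMk k) p ∈ V → rpMk k (H (p, 1)) = rpMk k p.2) ∧
      (∀ x y t, H ((-x, y), t) = -H ((x, y), t)) ∧
      ∀ x y t, H ((x, -y), t) = H ((x, y), t) := by
  classical
  have cov := isCoveringMap_rpMk k
  let γ : RP k × RP k → C(I, RP k) := fun p => if h : p ∈ V then s ⟨p, h⟩ else .const I p.1
  have hγ : ∀ p (h : p ∈ V), γ p = s ⟨p, h⟩ := fun p h => dif_pos h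
  have hγ0 : ∀ p, γ p 0 = p.1 := fun p => by
    by_cases h : p ∈ V
    · rw [hγ p h]
      exact congrArg Prod.fst (hs ⟨p, h⟩)
    · simp only [γ, dif_neg h, ContinuousMap.const_apply]
  have hγ1 : ∀ p, p ∈ V → γ p 1 = p.2 := fun p h => by
    rw [hγ p h]
    exact congrArg Prod.snd (hs ⟨p, h⟩)
  let L : (UnitSphere k ×
      UnitSphere k) →
      C(I, UnitSphere k) :=
    fun p => cov.liftPath (γ (Prod.map (rpMk k) (rpMk k) p)) p.1 (hγ0 _)
  have hL : ∀ p, rpMk k ∘ L p = γ (Prod.map (rpMk k) (rpMk k) p) := fun p =>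
    cov.liftPath_lifts _ _ _
  have hL0 : ∀ p, L p 0 = p.1 := fun p => cov.liftPath_zero _ _ _
  refine ⟨fun p => L p.1 p.2, ?_, hL0, fun p hp => ?_, fun x y t => ?_, fun x y t => ?_⟩
  · let f : C(I × (Prod.map (rpMk k) (rpMk k) ⁻¹' V), RP k) :=
      ⟨fun p => s ⟨Prod.map (rpMk k) (rpMk k) p.2, p.2.2⟩ p.1, by
        have hc := (isQuotientMap_rpMk k).continuous
        have : Continuous fun p : I × (Prod.map (rpMk k) (rpMk k) ⁻¹' V) =>
            s ⟨Prod.map (rpMk k) (rpMk k) p.2, p.2.2⟩ :=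
          s.continuous.comp (Continuous.subtype_mk
            ((hc.prodMap hc).comp (continuous_subtype_val.comp continuous_snd)) _)
        exact this.eval continuous_fst⟩
    have hlift : Continuous fun p : I × (Prod.map (rpMk k) (rpMk k) ⁻¹' V) => L p.2 p.1 := by
      refine cov.isLocalHomeomorph.continuous_lift cov.isSeparatedMap f ?_ ?_ ?_
      · ext p
        have := congrFun (hL p.2) p.1
        rw [hγ _ p.2.2] at this
        exact this
      · simp only [hL0]
        fun_prop
      · exact fun p => (L p).continuous
    rw [continuousOn_iff_continuous_domRestrict]
    exact hlift.comp (g := fun p : I × (Prod.map (rpMk k) (rpMk k) ⁻¹' V) => L p.2 p.1)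
      (f := fun p : ↥((Prod.map (rpMk k) (rpMk k) ⁻¹' V) ×ˢ (univ : Set I)) =>
        (p.1.2, ⟨p.1.1, p.2.1⟩)) (by fun_prop)
  · exact (congrFun (hL p) 1).trans (hγ1 _ hp)
  · have : (fun t => -L (x, y) t) = L (-x, y) := by
      refine (cov.eq_liftPath_iff _).2 ⟨(L (x, y)).continuous.neg, ?_, congrArg _ (hL0 _)⟩
      ext t
      have := congrFun (hL (x, y)) t
      simpa [rpMk_neg] using this
    exact (congrFun this t).symm
  · have : (L (x, y) : I → _) = L (x, -y) := by
      refine (cov.eq_liftPath_iff _).2 ⟨(L (x, y)).continuous, ?_, hL0 _⟩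
      have := hL (x, y)
      simpa [rpMk_neg] using this
    exact (congrFun this t).symm

/-- The basis vectors, as points of the unit sphere. -/
def basisPoint {k : ℕ} (i : Fin (k + 1)) : UnitSphere k :=
  ⟨EuclideanSpace.single i 1, by simp⟩

/-- The representative of the antipodal class of `x` with nonnegative `i`-th coordinate. -/
def flipSign {k : ℕ} (i : Fin (k + 1)) (x : UnitSphere k) : UnitSphere k :=
  if 0 < (x : EuclideanSpace ℝ (Fin (k + 1))) i then x else -x

/-- The set of points of the sphere with nonzero `i`-th coordinate. -/
def coordNeZero {k : ℕ} (i : Fin (k + 1)) : Set (UnitSphere k) :=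
  {x | (x : EuclideanSpace ℝ (Fin (k + 1))) i ≠ 0}

section Coordinates

variable {k : ℕ} {i : Fin (k + 1)} {x : UnitSphere k}

lemma continuous_coord (i : Fin (k + 1)) :
    Continuous fun x : UnitSphere k => (x : EuclideanSpace ℝ (Fin (k + 1))) i := by
  fun_prop

lemma isOpen_coordNeZero (i : Fin (k + 1)) : IsOpen (coordNeZero i) :=
  isOpen_ne_fun (continuous_coord i) continuous_const

lemma neg_mem_coordNeZero (hx : x ∈ coordNeZero i) : -x ∈ coordNeZero i := by
  simpa [coordNeZero] using hx

lemma exists_mem_coordNeZero (x : UnitSphere k) : ∃ i, x ∈ coordNeZero i := by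
  by_contra! h
  refine ne_zero_of_mem_unit_sphere x ?_
  ext i
  exact not_not.1 (h i)

lemma flipSign_neg (hx : x ∈ coordNeZero i) : flipSign i (-x) = flipSign i x := by
  rcases lt_or_gt_of_ne (show (x : EuclideanSpace ℝ (Fin (k + 1))) i ≠ 0 from hx) with h | h <;>
    simp [flipSign, h, h.not_gt]

lemma flipSign_pos (hx : x ∈ coordNeZero i) :
    0 < (flipSign i x : EuclideanSpace ℝ (Fin (k + 1))) i := by
  rcases lt_or_gt_of_ne (show (x : EuclideanSpace ℝ (Fin (k + 1))) i ≠ 0 from hx) with h | h <;>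
    simp [flipSign, h, h.not_gt]

lemma rpMk_flipSign (i : Fin (k + 1)) (x : UnitSphere k) : rpMk k (flipSign i x) = rpMk k x := by
  unfold flipSign
  split_ifs
  · rfl
  · exact rpMk_neg k x

lemma continuousOn_flipSign (i : Fin (k + 1)) : ContinuousOn (flipSign i) (coordNeZero i) := by
  have : coordNeZero i = {x : UnitSphere k | 0 < (x : EuclideanSpace ℝ (Fin (k + 1))) i} ∪
      {x : UnitSphere k | (x : EuclideanSpace ℝ (Fin (k + 1))) i < 0} := by
    ext x
    exact (ne_iff_lt_or_gt.trans or_comm)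
  rw [this]
  exact continuousOn_ite_of_isOpen _ (isOpen_lt continuous_const (continuous_coord i))
    (isOpen_lt (continuous_coord i) continuous_const) continuousOn_id continuous_neg.continuousOn
    (fun z hz => hz) fun z hz => not_lt_of_gt hz

lemma basisPoint_ne_neg (i j : Fin (k + 1)) : basisPoint i ≠ -basisPoint j := fun h => by
  have := congrArg (fun x : UnitSphere k => (x : EuclideanSpace ℝ (Fin (k + 1))) i) h
  by_cases hij : i = j
  · subst hij
    norm_num [basisPoint] at this
  · simp [basisPoint, hij] at this

lemma flipSign_ne_neg_basisPoint (hx : x ∈ coordNeZero i) :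
    flipSign i x ≠ -basisPoint i := fun h => by
  have := flipSign_pos hx
  rw [h] at this
  norm_num [basisPoint] at this

end Coordinates

lemma exists_section_RP (k : ℕ) (i j : Fin (k + 1)) :
    IsOpen (Prod.map (rpMk k) (rpMk k) '' (coordNeZero i ×ˢ coordNeZero j)) ∧
      ∃ s : C(Prod.map (rpMk k) (rpMk k) '' (coordNeZero i ×ˢ coordNeZero j), C(I, RP k)),
        ∀ u, pathEval (RP k) (s u) = u := by
  refine exists_section_of_lift (isOpenQuotientMap_rpMk k) (rpMk_eq_iff k)
    ((isOpen_coordNeZero i).prod (isOpen_coordNeZero j))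
    (fun x y h => ⟨neg_mem_coordNeZero h.1, h.2⟩)
    (fun x y h => ⟨h.1, neg_mem_coordNeZero h.2⟩)
    (fun p => spherePath (flipSign i p.1.1) (basisPoint i) (basisPoint j) (flipSign j p.1.2) p.2)
    ?_ (fun x y h => ?_) (fun x y h => ?_) (fun x y t h => ?_) (fun x y t h => ?_)
  · exact continuousOn_spherePath
      (a := fun p : UnitSphere k × UnitSphere k => flipSign i p.1) (b := fun _ => basisPoint i)
      (c := fun _ => basisPoint j) (d := fun p => flipSign j p.2)
      ((continuousOn_flipSign i).comp continuousOn_fst fun p hp => hp.1)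
      continuousOn_const continuousOn_const
      ((continuousOn_flipSign j).comp continuousOn_snd fun p hp => hp.2)
      (fun p hp => flipSign_ne_neg_basisPoint hp.1) (fun p hp => basisPoint_ne_neg i j)
      (fun p hp h => flipSign_ne_neg_basisPoint hp.2 (by rw [h, neg_neg]))
  · rw [spherePath_zero, rpMk_flipSign]
  · rw [spherePath_one, rpMk_flipSign]
  · dsimp only
    rw [flipSign_neg h.1]
  · dsimp only
    rw [flipSign_neg h.2]

lemma exists_TCCover_RP (k : ℕ) : ∃ c, TCCover (RP k) c := by
  obtain ⟨c, hc⟩ := Nat.exists_eq_add_one_of_ne_zero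
    (Fintype.card_ne_zero (α := Fin (k + 1) × Fin (k + 1)))
  refine ⟨c, TCCover.of_fintype hc
    (fun ij => Prod.map (rpMk k) (rpMk k) '' (coordNeZero ij.1 ×ˢ coordNeZero ij.2))
    (fun ij => (exists_section_RP k ij.1 ij.2).1) ?_ fun ij => (exists_section_RP k ij.1 ij.2).2⟩
  refine eq_univ_of_forall fun ⟨a, b⟩ => ?_
  obtain ⟨x, rfl⟩ := (isQuotientMap_rpMk k).surjective a
  obtain ⟨y, rfl⟩ := (isQuotientMap_rpMk k).surjective b
  obtain ⟨i, hi⟩ := exists_mem_coordNeZero x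
  obtain ⟨j, hj⟩ := exists_mem_coordNeZero y
  exact mem_iUnion.2 ⟨(i, j), (x, y), ⟨hi, hj⟩, rfl⟩

/-- `G` is a continuous equivariant motion planner for the antipodal action on `Sᵐ`, defined on
the invariant open set `U`. -/
structure IsAntipodalPlanner (m : ℕ) (U : Set (UnitSphere m × UnitSphere m))
    (G : (UnitSphere m × UnitSphere m) × I → UnitSphere m) : Prop where
  isOpen : IsOpen U
  neg_mem : ∀ x y, (x, y) ∈ U → (-x, -y) ∈ U
  continuousOn : ContinuousOn G (U ×ˢ univ)
  source : ∀ p, G (p, 0) = p.1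
  target : ∀ p, G (p, 1) = p.2
  map_neg : ∀ x y t, (x, y) ∈ U → G ((-x, -y), t) = -G ((x, y), t)

lemma exists_planner_of_waypoint {m : ℕ} {τ : ℝ} (h0 : -1 < τ) (h1 : τ < 1)
    {D : Set (UnitSphere m)} (hD : IsOpen D) (hDn : ∀ x ∈ D, -x ∈ D)
    {w : UnitSphere m → UnitSphere m} (hw : ContinuousOn w D) (hwn : ∀ x ∈ D, w (-x) = -w x)
    (hw₁ : ∀ x ∈ D, w x ≠ x) (hw₂ : ∀ x ∈ D, w x ≠ -x) :
    ∃ G, IsAntipodalPlanner m {p | inner ℝ (p.1 : EuclideanSpace ℝ (Fin (m + 1))) p.2 ≠ τ ∧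
      p.1 ∈ D} G := by
  classical
  let c : UnitSphere m × UnitSphere m → ℝ :=
    fun p => inner ℝ (p.1 : EuclideanSpace ℝ (Fin (m + 1))) p.2
  have hc : Continuous c := by fun_prop
  have hcn : ∀ x y, c (-x, -y) = c (x, y) := fun x y => by simp [c]
  have hc1 : ∀ x, c (x, x) = 1 := fun x => by simp [c]
  have hcm : ∀ x, c (x, -x) = -1 := fun x => by simp [c]
  let b : UnitSphere m × UnitSphere m → UnitSphere m := fun p => if τ < c p then p.1 else w p.1
  let d : UnitSphere m × UnitSphere m → UnitSphere m := fun p => if τ < c p then p.1 else -p.1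
  set U := {p : UnitSphere m × UnitSphere m | c p ≠ τ ∧ p.1 ∈ D} with hU
  have hDo : IsOpen {p : UnitSphere m × UnitSphere m | p.1 ∈ D} := hD.preimage continuous_fst
  have hA : IsOpen {p : UnitSphere m × UnitSphere m | τ < c p ∧ p.1 ∈ D} :=
    (isOpen_lt continuous_const hc).inter hDo
  have hB : IsOpen {p : UnitSphere m × UnitSphere m | c p < τ ∧ p.1 ∈ D} :=
    (isOpen_lt hc continuous_const).inter hDo
  have hAB : U = {p : UnitSphere m × UnitSphere m | τ < c p ∧ p.1 ∈ D} ∪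
      {p : UnitSphere m × UnitSphere m | c p < τ ∧ p.1 ∈ D} := by
    ext p
    simp only [hU, mem_ofPred_eq, mem_union, ne_iff_lt_or_gt]
    tauto
  have hb : ContinuousOn b U := by
    rw [hAB]
    exact continuousOn_ite_of_isOpen _ hA hB continuousOn_fst
      (hw.comp continuousOn_fst fun p hp => hp.2) (fun p hp => hp.1)
      fun p hp => not_lt_of_gt hp.1
  have hd : ContinuousOn d U := by
    rw [hAB]
    exact continuousOn_ite_of_isOpen _ hA hB continuousOn_fst continuousOn_fst.neg
      (fun p hp => hp.1) fun p hp => not_lt_of_gt hp.1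
  have hself : ∀ x : UnitSphere m, x ≠ -x := fun x h => by
    have := hcm x
    rw [← h, hc1] at this
    norm_num at this
  have e1 : ∀ p ∈ U, p.1 ≠ -b p := fun p hp h => by
    dsimp only [b] at h
    split_ifs at h
    · exact hself _ h
    · exact hw₂ _ hp.2 (by rw [h, neg_neg, ← h])
  have e2 : ∀ p ∈ U, b p ≠ -d p := fun p hp h => by
    dsimp only [b, d] at h
    split_ifs at h
    · exact hself _ h
    · exact hw₁ _ hp.2 (by rw [h, neg_neg])
  have e3 : ∀ p ∈ U, d p ≠ -p.2 := fun p hp h => by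
    dsimp only [d] at h
    split_ifs at h with hlt
    · have : c p = -1 := by
        have h2 : p = (p.1, -p.1) := Prod.ext rfl (by rw [h, neg_neg])
        rw [h2, hcm]
      linarith
    · have : c p = 1 := by
        have h2 : p = (p.1, p.1) := Prod.ext rfl (neg_injective h).symm
        rw [h2, hc1]
      linarith
  refine ⟨fun p => spherePath p.1.1 (b p.1) (d p.1) p.1.2 p.2, ?_, ?_, ?_, ?_, ?_, ?_⟩
  · rw [hAB]
    exact hA.union hB
  · exact fun x y h => ⟨(hcn x y).trans_ne h.1, hDn _ h.2⟩
  · exact continuousOn_spherePath continuousOn_fst hb hd continuousOn_snd e1 e2 e3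
  · exact fun p => spherePath_zero _ _ _ _
  · exact fun p => spherePath_one _ _ _ _
  · intro x y t h
    have hbn : b (-x, -y) = -b (x, y) := by
      simp only [b, hcn, hwn x h.2]
      split_ifs <;> rfl
    have hdn : d (-x, -y) = -d (x, y) := by
      simp only [d, hcn]
      split_ifs <;> rfl
    dsimp only
    rw [hbn, hdn]
    exact spherePath_neg (e1 _ h) (e2 _ h) (e3 _ h) t

/-- The skew-symmetric operator `x ↦ (± x_{rev i})ᵢ`, whose kernel is spanned by the middle basis
vector, if there is one. -/
def skewRev {m : ℕ} (x : EuclideanSpace ℝ (Fin (m + 1))) : EuclideanSpace ℝ (Fin (m + 1)) :=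
  WithLp.toLp 2 fun i => (if i < i.rev then 1 else if i.rev < i then -1 else 0) * x i.rev

section SkewRev

variable {m : ℕ}

lemma continuous_skewRev : Continuous (skewRev (m := m)) := by
  unfold skewRev
  fun_prop

lemma skewRev_neg (x : EuclideanSpace ℝ (Fin (m + 1))) : skewRev (-x) = -skewRev x := by
  ext i
  simp [skewRev]

lemma inner_skewRev_self (x : EuclideanSpace ℝ (Fin (m + 1))) : inner ℝ (skewRev x) x = 0 := by
  have h : inner ℝ (skewRev x) x = -inner ℝ (skewRev x) x := by
    simp only [PiLp.inner_apply, ← Finset.sum_neg_distrib]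
    rw [← Equiv.sum_comp Fin.revPerm]
    refine Finset.sum_congr rfl fun i _ => ?_
    simp only [skewRev, Fin.revPerm_apply, Fin.rev_rev, RCLike.inner_apply, conj_trivial]
    rcases lt_trichotomy i i.rev with h | h | h
    · simp [h, h.not_gt]; ring
    · rw [← h]; simp
    · simp [h, h.not_gt]; ring
  linarith

lemma apply_eq_zero_of_skewRev_eq_zero {x : EuclideanSpace ℝ (Fin (m + 1))}
    (hx : skewRev x = 0) {i : Fin (m + 1)} (hi : i ≠ i.rev) : x i = 0 := by
  have := congrArg (fun y : EuclideanSpace ℝ (Fin (m + 1)) => y i.rev) hx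
  simp only [skewRev, Fin.rev_rev, PiLp.zero_apply] at this
  rcases lt_or_gt_of_ne hi with h | h
  · simpa [h, h.not_gt] using this
  · simpa [h, h.not_gt] using this

lemma toSphere_skewRev_ne {x : UnitSphere m} (hx : skewRev (x : EuclideanSpace ℝ (Fin (m + 1))) ≠ 0) :
    toSphere x (skewRev (x : EuclideanSpace ℝ (Fin (m + 1)))) ≠ x ∧
      toSphere x (skewRev (x : EuclideanSpace ℝ (Fin (m + 1)))) ≠ -x := by
  have h : inner ℝ (toSphere x (skewRev (x : EuclideanSpace ℝ (Fin (m + 1)))) :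
      EuclideanSpace ℝ (Fin (m + 1))) x = 0 := by
    rw [coe_toSphere _ hx, inner_smul_left, inner_skewRev_self, mul_zero]
  constructor <;> intro h' <;> rw [h'] at h <;> simp at h

lemma toSphere_skewRev_neg {x : UnitSphere m} (hx : skewRev (x : EuclideanSpace ℝ (Fin (m + 1))) ≠ 0) :
    toSphere (-x) (skewRev ((-x : UnitSphere m) : EuclideanSpace ℝ (Fin (m + 1)))) =
      -toSphere x (skewRev (x : EuclideanSpace ℝ (Fin (m + 1)))) := by
  rw [coe_neg_sphere, skewRev_neg, toSphere_neg _ x hx]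

lemma skewRev_ne_zero_of_odd (hm : ¬ Even m) (x : UnitSphere m) :
    skewRev (x : EuclideanSpace ℝ (Fin (m + 1))) ≠ 0 := fun h => by
  refine ne_zero_of_mem_unit_sphere x ?_
  ext i
  refine apply_eq_zero_of_skewRev_eq_zero h fun hi => hm ?_
  have := congrArg Fin.val hi
  rw [Fin.val_rev] at this
  exact ⟨i, by omega⟩

lemma skewRev_ne_zero_of_abs_lt {i : Fin (m + 1)} (hi : i = i.rev) {x : UnitSphere m}
    (hx : |(x : EuclideanSpace ℝ (Fin (m + 1))) i| < 1) :
    skewRev (x : EuclideanSpace ℝ (Fin (m + 1))) ≠ 0 := fun h => by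
  have h0 : ∀ j, j ≠ i → (x : EuclideanSpace ℝ (Fin (m + 1))) j = 0 := fun j hj => by
    refine apply_eq_zero_of_skewRev_eq_zero h fun hj' => hj ?_
    have h1 := congrArg Fin.val hi
    have h2 := congrArg Fin.val hj'
    rw [Fin.val_rev] at h1 h2
    ext
    omega
  have h1 : (x : EuclideanSpace ℝ (Fin (m + 1))) =
      EuclideanSpace.single i ((x : EuclideanSpace ℝ (Fin (m + 1))) i) := by
    ext j
    by_cases hj : j = i
    · subst hj; simp
    · simp [hj, h0 j hj]
  have h2 := norm_eq_of_mem_sphere x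
  rw [h1, PiLp.norm_single, Real.norm_eq_abs] at h2
  linarith

end SkewRev

lemma exists_planner_of_odd {m : ℕ} (hm : ¬ Even m) {τ : ℝ} (h0 : -1 < τ) (h1 : τ < 1) :
    ∃ U G, IsAntipodalPlanner m U G ∧
      ∀ p : UnitSphere m × UnitSphere m,
        inner ℝ (p.1 : EuclideanSpace ℝ (Fin (m + 1))) p.2 ≠ τ → p ∈ U := by
  obtain ⟨G, hG⟩ := exists_planner_of_waypoint h0 h1 (isOpen_univ (X := UnitSphere m))
    (fun _ _ => mem_univ _)
    (w := fun x => toSphere x (skewRev (x : EuclideanSpace ℝ (Fin (m + 1)))))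
    (ContinuousOn.toSphere (continuous_skewRev.comp continuous_subtype_val).continuousOn
      (fun x _ => skewRev_ne_zero_of_odd hm x) _)
    (fun x _ => toSphere_skewRev_neg (skewRev_ne_zero_of_odd hm x))
    (fun x _ => (toSphere_skewRev_ne (skewRev_ne_zero_of_odd hm x)).1)
    fun x _ => (toSphere_skewRev_ne (skewRev_ne_zero_of_odd hm x)).2
  exact ⟨_, G, hG, fun p hp => ⟨hp, mem_univ _⟩⟩

lemma exists_planner_of_even {m : ℕ} (hm0 : 1 ≤ m) (hm : Even m) :
    ∃ i : Fin (m + 1), ∀ τ : ℝ, 0 < τ → τ < 1 → ∃ U G, IsAntipodalPlanner m U G ∧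
      ∀ p : UnitSphere m × UnitSphere m,
        inner ℝ (p.1 : EuclideanSpace ℝ (Fin (m + 1))) p.2 ≠ τ →
        |(p.1 : EuclideanSpace ℝ (Fin (m + 1))) i| ≠ τ → p ∈ U := by
  classical
  obtain ⟨l, hl⟩ := hm
  let i : Fin (m + 1) := ⟨l, by omega⟩
  have hi : i = i.rev := by
    ext
    rw [Fin.val_rev]
    change l = m + 1 - (l + 1)
    omega
  have hi0 : i ≠ 0 := fun h => by
    have : l = 0 := congrArg Fin.val h
    omega
  refine ⟨i, fun τ h0 h1 => ?_⟩
  let v : UnitSphere m → ℝ := fun x => (x : EuclideanSpace ℝ (Fin (m + 1))) i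
  have hv : Continuous v := continuous_coord i
  have hvn : ∀ x, v (-x) = -v x := fun x => by simp [v]
  let f : UnitSphere m := basisPoint 0
  have hf : v f = 0 := by simp [v, f, basisPoint, hi0]
  let g : UnitSphere m → UnitSphere m := fun x => if 0 < v x then f else -f
  let w : UnitSphere m → UnitSphere m := fun x =>
    if |v x| < τ then toSphere x (skewRev (x : EuclideanSpace ℝ (Fin (m + 1)))) else g x
  have hsk : ∀ x, |v x| < τ → skewRev (x : EuclideanSpace ℝ (Fin (m + 1))) ≠ 0 := fun x hx =>
    skewRev_ne_zero_of_abs_lt hi (hx.trans h1)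
  have hg : ContinuousOn g {x | τ < |v x|} := by
    refine (continuousOn_ite_of_isOpen (A := {x | 0 < v x}) (B := {x | v x < 0}) _
      (isOpen_lt continuous_const hv) (isOpen_lt hv continuous_const)
      continuousOn_const continuousOn_const (fun x hx => hx)
      fun x (hx : v x < 0) => not_lt_of_gt hx).mono ?_
    intro x hx
    exact (lt_or_gt_of_ne (abs_pos.1 (h0.trans hx))).symm
  have hw : ContinuousOn w {x | |v x| ≠ τ} := by
    have : {x | |v x| ≠ τ} = {x | |v x| < τ} ∪ {x | τ < |v x|} := by
      ext x
      exact ne_iff_lt_or_gt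
    rw [this]
    exact continuousOn_ite_of_isOpen _ (isOpen_lt hv.abs continuous_const)
      (isOpen_lt continuous_const hv.abs)
      (ContinuousOn.toSphere (continuous_skewRev.comp continuous_subtype_val).continuousOn hsk _)
      hg (fun x hx => hx) fun x hx => not_lt_of_gt hx
  have hgv : ∀ x, v (g x) = 0 := fun x => by
    dsimp only [g]
    split_ifs
    · exact hf
    · rw [hvn, hf, neg_zero]
  have hwn : ∀ x ∈ {x | |v x| ≠ τ}, w (-x) = -w x := by
    intro x hx
    by_cases h : |v x| < τ
    · simp only [w, hvn, abs_neg, h, if_true, toSphere_skewRev_neg (hsk x h)]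
    · have hx0 : v x ≠ 0 := abs_pos.1 (h0.trans_le (not_lt.1 h))
      simp only [w, hvn, abs_neg, h, if_false, g]
      rcases lt_or_gt_of_ne hx0 with h' | h' <;> simp [h', h'.not_gt]
  have hw₁ : ∀ x ∈ {x | |v x| ≠ τ}, w x ≠ x := by
    intro x hx
    by_cases h : |v x| < τ
    · simp only [w, h, if_true]
      exact (toSphere_skewRev_ne (hsk x h)).1
    · have hx0 : v x ≠ 0 := abs_pos.1 (h0.trans_le (not_lt.1 h))
      simp only [w, h, if_false]
      exact fun h' => hx0 (by rw [← h', hgv])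
  have hw₂ : ∀ x ∈ {x | |v x| ≠ τ}, w x ≠ -x := by
    intro x hx
    by_cases h : |v x| < τ
    · simp only [w, h, if_true]
      exact (toSphere_skewRev_ne (hsk x h)).2
    · have hx0 : v x ≠ 0 := abs_pos.1 (h0.trans_le (not_lt.1 h))
      simp only [w, h, if_false]
      exact fun h' => hx0 (by rw [← neg_eq_zero, ← hvn, ← h', hgv])
  obtain ⟨G, hG⟩ := exists_planner_of_waypoint (by linarith) h1
    (D := {x | |v x| ≠ τ}) (isOpen_ne_fun hv.abs continuous_const)
    (fun x hx => by simpa [hvn] using hx) hw hwn hw₁ hw₂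
  exact ⟨_, G, hG, fun p hp hp' => ⟨hp, hp'⟩⟩

lemma exists_card_le_one_of_injective {α β : Type*} {τ : α → β} (hτ : τ.Injective) (b : β) :
    ∃ F : Finset α, F.card ≤ 1 ∧ ∀ s ∉ F, b ≠ τ s := by
  by_cases h : ∃ s, b = τ s
  · obtain ⟨s, rfl⟩ := h
    exact ⟨{s}, by simp, fun s' hs' h => hs' (by simp [hτ h])⟩
  · push Not at h
    exact ⟨∅, by simp, fun s _ => h s⟩

lemma exists_planner_family {m : ℕ} (hm : 1 ≤ m) :
    ∃ (U : ℕ → Set (UnitSphere m × UnitSphere m))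
      (G : ℕ → (UnitSphere m × UnitSphere m) × I → UnitSphere m),
      (∀ s, IsAntipodalPlanner m (U s) (G s)) ∧
      ∀ p, ∃ F : Finset ℕ, F.card ≤ 1 + (if Even m then 1 else 0) ∧ ∀ s ∉ F, p ∈ U s := by
  classical
  let τ : ℕ → ℝ := fun s => 1 / ((s : ℝ) + 2)
  have hτ : τ.Injective := fun a b h => by
    have : (a : ℝ) + 2 = b + 2 := by
      simpa [τ] using h
    exact_mod_cast add_right_cancel this
  have h0 : ∀ s, 0 < τ s := fun s => by positivity
  have h1 : ∀ s, τ s < 1 := fun s => by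
    have : (0 : ℝ) ≤ s := s.cast_nonneg
    exact (div_lt_one (by positivity)).2 (by linarith)
  by_cases he : Even m
  · obtain ⟨i, hi⟩ := exists_planner_of_even hm he
    choose U G hG hU using fun s => hi (τ s) (h0 s) (h1 s)
    refine ⟨U, G, hG, fun p => ?_⟩
    obtain ⟨F, hF, hF'⟩ := exists_card_le_one_of_injective hτ
      (inner ℝ (p.1 : EuclideanSpace ℝ (Fin (m + 1))) p.2)
    obtain ⟨F₂, hF₂, hF₂'⟩ := exists_card_le_one_of_injective hτ
      |(p.1 : EuclideanSpace ℝ (Fin (m + 1))) i|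
    refine ⟨F ∪ F₂, ?_, fun s hs => ?_⟩
    · rw [if_pos he]
      exact (Finset.card_union_le _ _).trans (add_le_add hF hF₂)
    · rw [Finset.notMem_union] at hs
      exact hU s p (hF' s hs.1) (hF₂' s hs.2)
  · choose U G hG hU using fun s => exists_planner_of_odd he (by linarith [h0 s]) (h1 s)
    refine ⟨U, G, hG, fun p => ?_⟩
    obtain ⟨F, hF, hF'⟩ := exists_card_le_one_of_injective hτ
      (inner ℝ (p.1 : EuclideanSpace ℝ (Fin (m + 1))) p.2)
    exact ⟨F, by rwa [if_neg he], fun s hs => hU s p (hF' s hs)⟩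

lemma exists_sign_normalization {r : ℕ} (n : Fin r → ℕ) (i₀ : Fin r)
    {V : Set (RP (n i₀) × RP (n i₀))} (hV : IsOpen V) (s : C(V, C(I, RP (n i₀))))
    (hs : ∀ u : V, pathEval _ (s u) = (u : RP (n i₀) × RP (n i₀))) :
    ∃ V' : Set (SphereProd n × SphereProd n),
      V' = {z | (rpMk (n i₀) (z.1 i₀), rpMk (n i₀) (z.2 i₀)) ∈ V} ∧ IsOpen V' ∧
    ∃ (ν : SphereProd n × SphereProd n → SphereProd n)
      (H : (SphereProd n × SphereProd n) × I → UnitSphere (n i₀)),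
      ContinuousOn ν V' ∧ (∀ z, ν z = z.2 ∨ ν z = -z.2) ∧
      (∀ x y, (x, y) ∈ V' → ν (-x, y) = -ν (x, y) ∧ ν (x, -y) = ν (x, y)) ∧
      ContinuousOn H (V' ×ˢ univ) ∧
      (∀ z ∈ V', H (z, 0) = z.1 i₀ ∧ H (z, 1) = ν z i₀) ∧
      ∀ x y t, (x, y) ∈ V' → H ((-x, y), t) = -H ((x, y), t) ∧ H ((x, -y), t) = H ((x, y), t) := by
  classical
  obtain ⟨H, hH, hH0, hH1, hHx, hHy⟩ := exists_sphere_lift (n i₀) s hs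
  let π : SphereProd n × SphereProd n → UnitSphere (n i₀) × UnitSphere (n i₀) :=
    fun z => (z.1 i₀, z.2 i₀)
  have hπ : Continuous π := by fun_prop
  let V' : Set (SphereProd n × SphereProd n) :=
    {z | (rpMk (n i₀) (z.1 i₀), rpMk (n i₀) (z.2 i₀)) ∈ V}
  have hq := (isQuotientMap_rpMk (n i₀)).continuous
  have hVo : IsOpen V' := hV.preimage ((hq.prodMap hq).comp hπ)
  let c : SphereProd n × SphereProd n → ℝ := fun z =>
    inner ℝ (H (π z, 1) : EuclideanSpace ℝ (Fin (n i₀ + 1))) (z.2 i₀)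
  have hc : ContinuousOn c V' := by
    have h1 : ContinuousOn (fun z => H (π z, 1)) V' :=
      hH.comp (f := fun z => (π z, (1 : I))) (by fun_prop) fun z hz => ⟨hz, mem_univ _⟩
    have h2 : ContinuousOn (fun z => (H (π z, 1) : EuclideanSpace ℝ (Fin (n i₀ + 1)))) V' :=
      continuous_subtype_val.comp_continuousOn h1
    exact ContinuousOn.inner (𝕜 := ℝ) h2 (by fun_prop : Continuous fun z : SphereProd n × SphereProd n =>
      (z.2 i₀ : EuclideanSpace ℝ (Fin (n i₀ + 1)))).continuousOn
  have hend : ∀ z ∈ V', (0 < c z ∧ H (π z, 1) = z.2 i₀) ∨ (c z < 0 ∧ H (π z, 1) = -z.2 i₀) := by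
    intro z hz
    rcases (rpMk_eq_iff _ _ _).1 (hH1 (π z) hz) with h | h
    · have h' : z.2 i₀ = H (π z, 1) := h
      left
      simp [c, h']
    · have h' : H (π z, 1) = -z.2 i₀ := by
        have : z.2 i₀ = -H (π z, 1) := h
        rw [this, neg_neg]
      right
      simp [c, h']
  have hcx : ∀ x y, c (-x, y) = -c (x, y) := fun x y => by
    have : H (π (-x, y), 1) = -H (π (x, y), 1) := hHx _ _ _
    simp [c, this]
  have hcy : ∀ x y, c (x, -y) = -c (x, y) := fun x y => by
    have : H (π (x, -y), 1) = H (π (x, y), 1) := hHy _ _ _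
    simp [c, this]
  let ν : SphereProd n × SphereProd n → SphereProd n := fun z => if 0 < c z then z.2 else -z.2
  refine ⟨V', rfl, hVo, ν, fun p => H (π p.1, p.2), ?_, fun z => ?_, fun x y h => ?_, ?_,
    fun z hz => ⟨hH0 _, ?_⟩, fun x y t h => ⟨hHx _ _ _, hHy _ _ _⟩⟩
  · have : V' = (V' ∩ c ⁻¹' Ioi 0) ∪ (V' ∩ c ⁻¹' Iio 0) := by
      ext z
      constructor
      · intro hz
        rcases hend z hz with h | h
        · exact Or.inl ⟨hz, h.1⟩
        · exact Or.inr ⟨hz, h.1⟩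
      · rintro (h | h) <;> exact h.1
    rw [this]
    exact continuousOn_ite_of_isOpen _ (hc.isOpen_inter_preimage hVo isOpen_Ioi)
      (hc.isOpen_inter_preimage hVo isOpen_Iio) continuousOn_snd continuous_snd.neg.continuousOn
      (fun z hz => hz.2) fun z hz => not_lt_of_gt hz.2
  · dsimp only [ν]
    split_ifs
    · exact Or.inl rfl
    · exact Or.inr rfl
  · simp only [ν, hcx, hcy]
    rcases hend _ h with ⟨h, -⟩ | ⟨h, -⟩ <;> simp [h, h.not_gt]
  · exact hH.comp (f := fun p : (SphereProd n × SphereProd n) × I => (π p.1, p.2))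
      (by fun_prop) fun p hp => ⟨hp.1, mem_univ _⟩
  · dsimp only [ν]
    rcases hend z hz with ⟨h, h'⟩ | ⟨h, h'⟩
    · rw [if_pos h, h']
    · rw [if_neg h.not_gt, h', Pi.neg_apply]

lemma exists_section_PPS {r : ℕ} (n : Fin r → ℕ) (i₀ : Fin r)
    {V : Set (RP (n i₀) × RP (n i₀))} (hV : IsOpen V) (s : C(V, C(I, RP (n i₀))))
    (hs : ∀ u : V, pathEval _ (s u) = (u : RP (n i₀) × RP (n i₀))) :
    ∃ ν : SphereProd n × SphereProd n → SphereProd n,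
      ∀ (U : ∀ i, Set (UnitSphere (n i) × UnitSphere (n i)))
        (G : ∀ i, (UnitSphere (n i) × UnitSphere (n i)) × I → UnitSphere (n i)),
        (∀ i, IsAntipodalPlanner (n i) (U i) (G i)) →
        ∃ T : Set (PPS n × PPS n), IsOpen T ∧
          (∃ s : C(T, C(I, PPS n)), ∀ u : T, pathEval _ (s u) = (u : PPS n × PPS n)) ∧
          ∀ z : SphereProd n × SphereProd n,
            (rpMk (n i₀) (z.1 i₀), rpMk (n i₀) (z.2 i₀)) ∈ V →
            (∀ i, i ≠ i₀ → (z.1 i, ν z i) ∈ U i) → (ppsMk n z.1, ppsMk n z.2) ∈ T := by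
  obtain ⟨V', hV', hVo, ν, H, hν, hνe, hνn, hH, hHe, hHn⟩ :=
    exists_sign_normalization n i₀ hV s hs
  refine ⟨ν, fun U G hG => ?_⟩
  let κ : ∀ i, SphereProd n × SphereProd n → UnitSphere (n i) × UnitSphere (n i) :=
    fun i z => (z.1 i, ν z i)
  have hκ : ∀ i, ContinuousOn (κ i) V' := fun i =>
    ContinuousOn.prodMk (by fun_prop) ((continuous_apply i).comp_continuousOn hν)
  let W : Set (SphereProd n × SphereProd n) := {z | z ∈ V' ∧ ∀ i, i ≠ i₀ → κ i z ∈ U i}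
  have hWV : W ⊆ V' := fun z hz => hz.1
  have hWo : IsOpen W := by
    have h : W = V' ∩ ⋂ i, (V' ∩ {z | i ≠ i₀ → κ i z ∈ U i}) := by
      ext z
      simp only [W, mem_inter_iff, mem_iInter, mem_ofPred_eq]
      exact and_congr_right fun hz => forall_congr' fun i => by simp [hz]
    rw [h]
    refine hVo.inter (isOpen_iInter_of_finite fun i => ?_)
    by_cases hi : i = i₀
    · simpa [hi] using hVo
    · have : {z | i ≠ i₀ → κ i z ∈ U i} = κ i ⁻¹' U i := by
        ext z
        simp [hi]
      rw [this]
      exact (hκ i).isOpen_inter_preimage hVo (hG i).isOpen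
  have hVx : ∀ x y, (x, y) ∈ V' → (-x, y) ∈ V' := fun x y h => by
    rw [hV'] at h ⊢
    simpa [rpMk_neg] using h
  have hVy : ∀ x y, (x, y) ∈ V' → (x, -y) ∈ V' := fun x y h => by
    rw [hV'] at h ⊢
    simpa [rpMk_neg] using h
  have hκx : ∀ i x y, (x, y) ∈ V' → κ i (-x, y) = (-(κ i (x, y)).1, -(κ i (x, y)).2) :=
    fun i x y h => by simp [κ, (hνn x y h).1]
  have hκy : ∀ i x y, (x, y) ∈ V' → κ i (x, -y) = κ i (x, y) :=
    fun i x y h => by simp [κ, (hνn x y h).2]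
  have hK : ∀ i, ∃ K : (SphereProd n × SphereProd n) × I → UnitSphere (n i),
      ContinuousOn K (W ×ˢ univ) ∧ (∀ z ∈ W, K (z, 0) = z.1 i ∧ K (z, 1) = ν z i) ∧
      ∀ x y t, (x, y) ∈ W →
        K ((-x, y), t) = -K ((x, y), t) ∧ K ((x, -y), t) = K ((x, y), t) := fun i => by
    by_cases hi : i = i₀
    · subst hi
      exact ⟨H, hH.mono (prod_mono hWV Subset.rfl), fun z hz => hHe z hz.1,
        fun x y t h => hHn x y t h.1⟩
    · refine ⟨fun p => G i (κ i p.1, p.2), ?_, fun z hz => ⟨(hG i).source _, (hG i).target _⟩,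
        fun x y t h => ⟨?_, ?_⟩⟩
      · refine (hG i).continuousOn.comp (ContinuousOn.prodMk ?_ continuousOn_snd)
          fun p hp => ⟨hp.1.2 i hi, mem_univ _⟩
        exact (hκ i).comp continuousOn_fst fun p hp => hp.1.1
      · dsimp only
        rw [hκx i x y h.1]
        exact (hG i).map_neg _ _ _ (h.2 i hi)
      · dsimp only
        rw [hκy i x y h.1]
  choose K hKc hKe hKn using hK
  have hνq : ∀ z, ppsMk n (ν z) = ppsMk n z.2 := fun z => by
    refine (ppsMk_eq_iff n _ _).2 ?_
    rcases hνe z with h | h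
    · exact Or.inl h.symm
    · exact Or.inr (by rw [h, neg_neg])
  obtain ⟨hT, hsec⟩ := exists_section_of_lift (isOpenQuotientMap_ppsMk n) (ppsMk_eq_iff n) hWo
    (fun x y h => ⟨hVx x y h.1, fun i hi => by
      rw [hκx i x y h.1]
      exact (hG i).neg_mem _ _ (h.2 i hi)⟩)
    (fun x y h => ⟨hVy x y h.1, fun i hi => by
      rw [hκy i x y h.1]
      exact h.2 i hi⟩)
    (fun p i => K i p) (continuousOn_pi.2 hKc)
    (fun x y h => congrArg _ (funext fun i => (hKe i _ h).1))
    (fun x y h => (congrArg _ (funext fun i => (hKe i _ h).2)).trans (hνq _))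
    (fun x y t h => (ppsMk_eq_iff n _ _).2 (Or.inr (funext fun i => by
      rw [Pi.neg_apply, (hKn i x y t h).1, neg_neg])))
    (fun x y t h => congrArg _ (funext fun i => (hKn i x y t h).2))
  refine ⟨_, hT, hsec, fun z hz hzU => ⟨z, ⟨?_, hzU⟩, rfl⟩⟩
  rw [hV']
  exact hz

lemma TCCover_PPS {r : ℕ} {n : Fin r → ℕ} (hn : ∀ i, 1 ≤ n i) (i₀ : Fin r) {m c : ℕ}
    (hm : TCCover (RP (n i₀)) m)
    (hc : (m + 1) * (r + (Finset.univ.filter fun i => i ≠ i₀ ∧ Even (n i)).card) = c + 1) :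
    TCCover (PPS n) c := by
  classical
  set k := (Finset.univ.filter fun i => i ≠ i₀ ∧ Even (n i)).card with hk
  obtain ⟨V, hV, hVcov, hVs⟩ := hm
  choose s hs using hVs
  choose ν hν using fun j => exists_section_PPS n i₀ (hV j) (s j) (hs j)
  choose U G hG hUF using fun i => exists_planner_family (hn i)
  choose T hT hTs hTm using fun (j : Fin (m + 1)) (l : Fin (r + k)) =>
    hν j (fun i => U i l) (fun i => G i l) fun i => hG i l
  refine TCCover.of_fintype (ι := Fin (m + 1) × Fin (r + k)) (by simpa using hc)
    (fun jl => T jl.1 jl.2) (fun jl => hT _ _) ?_ fun jl => hTs _ _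
  refine eq_univ_of_forall fun ⟨a, b⟩ => ?_
  obtain ⟨x, rfl⟩ := (isOpenQuotientMap_ppsMk n).surjective a
  obtain ⟨y, rfl⟩ := (isOpenQuotientMap_ppsMk n).surjective b
  obtain ⟨j, hj⟩ := mem_iUnion.1 (hVcov.symm ▸ mem_univ
    ((rpMk (n i₀) (x i₀), rpMk (n i₀) (y i₀)) : RP (n i₀) × RP (n i₀)))
  choose F hF hFU using fun i => hUF i (x i, ν j (x, y) i)
  have hcard : ((Finset.univ.erase i₀).biUnion F).card < (Finset.range (r + k)).card := by
    have hr : 0 < r := i₀.pos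
    calc ((Finset.univ.erase i₀).biUnion F).card
        ≤ ∑ i ∈ Finset.univ.erase i₀, (F i).card := Finset.card_biUnion_le
      _ ≤ ∑ i ∈ Finset.univ.erase i₀, (1 + if Even (n i) then 1 else 0) :=
          Finset.sum_le_sum fun i _ => hF i
      _ = (r - 1) + k := by
          rw [Finset.sum_add_distrib, ← Finset.card_filter, Finset.sum_const, smul_eq_mul, mul_one,
            Finset.card_erase_of_mem (Finset.mem_univ _), Finset.card_univ, Fintype.card_fin, hk]
          congr 2
          ext i
          simp
      _ < (Finset.range (r + k)).card := by
          rw [Finset.card_range]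
          omega
  obtain ⟨l, hl, hlF⟩ := Finset.exists_mem_notMem_of_card_lt_card hcard
  refine mem_iUnion.2 ⟨(j, ⟨l, Finset.mem_range.1 hl⟩), hTm _ _ (x, y) hj fun i hi => ?_⟩
  refine hFU i l fun h => hlF ?_
  exact Finset.mem_biUnion.2 ⟨i, Finset.mem_erase.2 ⟨hi, Finset.mem_univ _⟩, h⟩

lemma topComplexity_le {X : Type*} [TopologicalSpace X] {c : ℕ} (h : TCCover X c) :
    topComplexity X ≤ c :=
  sInf_le ⟨c, h, rfl⟩

lemma exists_topComplexity_eq {X : Type*} [TopologicalSpace X] {c : ℕ} (h : TCCover X c) :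
    ∃ m, TCCover X m ∧ topComplexity X = m :=
  csInf_mem (s := {c : ℕ∞ | ∃ k : ℕ, TCCover X k ∧ c = k}) ⟨c, c, h, rfl⟩

/-- Let `n̄ = (n₁,…,n_r)` with `n₁ ≤ ⋯ ≤ n_r`, and let `k` be the number of indices
`i > 1` with `nᵢ` even. Then `TC(P_{n̄}) < (TC(P^{n₁}) + 1) · (r + k)`, where `TC` is the
reduced topological complexity. -/
theorem stmt18 (r : ℕ) (hr : 0 < r) (n : Fin r → ℕ)
    (hpos : ∀ i, 1 ≤ n i) (hmono : Monotone n) :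
    topComplexity (PPS n) <
      (topComplexity (RP (n ⟨0, hr⟩)) + 1) *
        ((r : ℕ∞) +
          ((Finset.univ.filter fun i : Fin r => i ≠ ⟨0, hr⟩ ∧ Even (n i)).card : ℕ∞)) := by
  obtain ⟨_, h⟩ := exists_TCCover_RP (n ⟨0, hr⟩)
  obtain ⟨m, hm, hTC⟩ := exists_topComplexity_eq h
  obtain ⟨c, hc⟩ := Nat.exists_eq_add_one_of_ne_zero (n := (m + 1) *
    (r + (Finset.univ.filter fun i : Fin r => i ≠ ⟨0, hr⟩ ∧ Even (n i)).card)) (by positivity)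
  refine (topComplexity_le (TCCover_PPS hpos ⟨0, hr⟩ hm hc)).trans_lt ?_
  rw [hTC]
  have hlt : c < (m + 1) *
      (r + (Finset.univ.filter fun i : Fin r => i ≠ ⟨0, hr⟩ ∧ Even (n i)).card) := by
    rw [hc]
    exact Nat.lt_succ_self c
  exact_mod_cast hlt

end
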